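/- Let S be an admissible shape of P_{m,n} with upper boundary segments [l⁽¹⁾,r⁽¹⁾], ..., [l⁽ᵗ⁾,r⁽ᵗ⁾]. Then for each j with 2 ≤ j ≤ t, the y-coordinate of l⁽ʲ⁾ lies in {r⁽ʲ⁻¹⁾_y − 1, r⁽ʲ⁻¹⁾_y, r⁽ʲ⁻¹⁾_y + 1}; that is, consecutive upper boundary segments meet with a vertical jump of height at most 1. -/

import Mathlib

open Set

noncomputable section

/-- A point of the integer lattice `ℤ² ⊆ ℝ²`. -/
def IsLatticePoint (p : ℝ × ℝ) : Prop := ∃ a b : ℤ, p = ((a : ℝ), (b : ℝ))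

/-- A triangle: the convex hull of three affinely independent points of `ℝ²`. -/
def IsTriangle (Δ : Set (ℝ × ℝ)) : Prop :=
  ∃ p q r : ℝ × ℝ, AffineIndependent ℝ ![p, q, r] ∧ Δ = convexHull ℝ {p, q, r}

/-- `F` is a face of the triangle `Δ`: the empty set, a vertex, an edge,
or the whole triangle. -/
def IsFaceOf (F Δ : Set (ℝ × ℝ)) : Prop :=
  ∃ p q r : ℝ × ℝ, AffineIndependent ℝ ![p, q, r] ∧ Δ = convexHull ℝ {p, q, r} ∧
    (F = ∅ ∨ F = {p} ∨ F = {q} ∨ F = {r} ∨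
     F = segment ℝ p q ∨ F = segment ℝ q r ∨ F = segment ℝ p r ∨ F = Δ)

/-- The determinant of the two edge vectors of the triangle `pqr` emanating
from `p`; its absolute value is twice the Euclidean area of the triangle. -/
def triDet (p q r : ℝ × ℝ) : ℝ :=
  (q.1 - p.1) * (r.2 - p.2) - (q.2 - p.2) * (r.1 - p.1)

/-- A unimodular triangle: a lattice triangle of area `1/2`. -/
def IsUnimodularTriangle (Δ : Set (ℝ × ℝ)) : Prop :=
  ∃ p q r : ℝ × ℝ, IsLatticePoint p ∧ IsLatticePoint q ∧ IsLatticePoint r ∧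
    AffineIndependent ℝ ![p, q, r] ∧ Δ = convexHull ℝ {p, q, r} ∧
    |triDet p q r| = 1

/-- `T` is a unimodular triangulation of the region `P`. -/
def IsUnimodularTriangulation (P : Set (ℝ × ℝ)) (T : Set (Set (ℝ × ℝ))) : Prop :=
  T.Finite ∧ (∀ Δ ∈ T, IsUnimodularTriangle Δ ∧ Δ ⊆ P) ∧ ⋃₀ T = P ∧
  ∀ Δ₁ ∈ T, ∀ Δ₂ ∈ T, IsFaceOf (Δ₁ ∩ Δ₂) Δ₁ ∧ IsFaceOf (Δ₁ ∩ Δ₂) Δ₂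

/-- The number of unimodular triangulations of the region `P`. -/
def numTriangulations (P : Set (ℝ × ℝ)) : ℕ :=
  Set.ncard {T | IsUnimodularTriangulation P T}

/-- `f m n` is the number of unimodular triangulations of `[0,m] × [0,n]`. -/
def f (m n : ℕ) : ℕ :=
  numTriangulations (Set.Icc (0, 0) ((m : ℝ), (n : ℝ)))

/-- `Δ₂` lies above `Δ₁` (written `Δ₁ ≺ Δ₂`). -/
def LiesAbove (Δ₁ Δ₂ : Set (ℝ × ℝ)) : Prop :=
  ∃ x y₁ y₂ : ℝ, (x, y₁) ∈ Δ₁ \ Δ₂ ∧ (x, y₂) ∈ Δ₂ \ Δ₁ ∧ y₁ < y₂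

/-- `Δ` is a `≺`-maximal triangle of the set of triangles `T`. -/
def MaximalIn (Δ : Set (ℝ × ℝ)) (T : Set (Set (ℝ × ℝ))) : Prop :=
  Δ ∈ T ∧ ∀ Δ' ∈ T, ¬ LiesAbove Δ Δ'

/-- An admissible sequence `T 1, …, T (2mn)` for `P_{m,n}`: `T 1` is a unimodular
triangulation of `[0,m] × [0,n]` and each subsequent set arises by removing a
`≺`-maximal triangle. -/
def IsAdmissibleSeq (m n : ℕ) (T : ℕ → Set (Set (ℝ × ℝ))) : Prop :=
  IsUnimodularTriangulation (Set.Icc (0, 0) ((m : ℝ), (n : ℝ))) (T 1) ∧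
  ∀ i, 2 ≤ i → i ≤ 2 * m * n →
    ∃ Δ, MaximalIn Δ (T (i - 1)) ∧ T i = T (i - 1) \ {Δ}

/-- An admissible shape of `P_{m,n}`: the union of the triangles of some member
of an admissible sequence. -/
def IsAdmissibleShape (m n : ℕ) (S : Set (ℝ × ℝ)) : Prop :=
  ∃ (T : ℕ → Set (Set (ℝ × ℝ))) (i : ℕ),
    IsAdmissibleSeq m n T ∧ 1 ≤ i ∧ i ≤ 2 * m * n ∧ S = ⋃₀ (T i)

/-- `Tmax S`: the set of all unimodular triangles contained in `S` that are
`≺`-maximal in some unimodular triangulation of `S`. -/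
def Tmax (S : Set (ℝ × ℝ)) : Set (Set (ℝ × ℝ)) :=
  {Δ | IsUnimodularTriangle Δ ∧ Δ ⊆ S ∧
    ∃ T, IsUnimodularTriangulation S T ∧ MaximalIn Δ T}

/-- `F` is a valid set of removed triangles turning `S` into the subshape `S'`:
`F ⊆ Tmax S`, the triangles of `F` have pairwise disjoint interiors, their
interiors are disjoint from `S'`, and `S = S' ∪ ⋃F`. -/
def IsRemovedSet (S' S : Set (ℝ × ℝ)) (F : Set (Set (ℝ × ℝ))) : Prop :=
  F ⊆ Tmax S ∧
  (∀ Δ₁ ∈ F, ∀ Δ₂ ∈ F, Δ₁ ≠ Δ₂ → interior Δ₁ ∩ interior Δ₂ = ∅) ∧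
  (∀ Δ ∈ F, interior Δ ∩ S' = ∅) ∧
  S = S' ∪ ⋃₀ F

/-- `S'` is an admissible subshape of `S`. -/
def IsAdmissibleSubshape (m n : ℕ) (S' S : Set (ℝ × ℝ)) : Prop :=
  IsAdmissibleShape m n S' ∧ ∃ F, IsRemovedSet S' S F

/-- `#(S',S)`: the number of triangles removed from `S` to obtain the admissible
subshape `S'` (well defined by the uniqueness of the removed set). -/
def removedCount (S' S : Set (ℝ × ℝ)) : ℕ :=
  sInf {k | ∃ F, IsRemovedSet S' S F ∧ F.ncard = k}

/-- `l, r : ℕ → ℝ × ℝ` (used at indices `1, …, t`) describe the sequence of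
upper boundary segments `[l 1, r 1], …, [l t, r t]` of the shape `S` inside
`P_{m,n}`: the segments run from `x = 0` to `x = m`, consecutive segments share
their `x`-coordinate, each segment lies in `S`, and no point strictly above the
relative interior of a segment belongs to `S`. -/
def IsUpperBoundary (m : ℕ) (S : Set (ℝ × ℝ)) (t : ℕ) (l r : ℕ → ℝ × ℝ) : Prop :=
  1 ≤ t ∧ (l 1).1 = 0 ∧ (r t).1 = (m : ℝ) ∧
  (∀ j, 2 ≤ j → j ≤ t → (l j).1 = (r (j - 1)).1) ∧
  (∀ j, 1 ≤ j → j ≤ t → (l j).1 < (r j).1) ∧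
  (∀ j, 1 ≤ j → j ≤ t → segment ℝ (l j) (r j) ⊆ S) ∧
  (∀ j, 1 ≤ j → j ≤ t → ∀ p ∈ openSegment ℝ (l j) (r j),
    ∀ ε : ℝ, 0 < ε → p + (0, ε) ∉ S)

open Filter Topology

theorem triDet_ne_zero_of_affineIndependent {p q r : ℝ × ℝ}
    (h : AffineIndependent ℝ ![p, q, r]) : triDet p q r ≠ 0 := by
  intro h0
  rw [affineIndependent_iff_linearIndependent_vsub ℝ _ (0 : Fin 3),
    ← linearIndependent_equiv (finSuccAboveEquiv (0 : Fin 3))] at h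
  have h2 : ∀ g : Fin 2 → ℝ, g 0 * (q.1 - p.1) + g 1 * (r.1 - p.1) = 0 →
      g 0 * (q.2 - p.2) + g 1 * (r.2 - p.2) = 0 → g 0 = 0 ∧ g 1 = 0 := by
    simpa [Fin.sum_univ_succ, finSuccAboveEquiv_apply, Fin.forall_fin_succ, Prod.ext_iff] using
      Fintype.linearIndependent_iff.1 h
  unfold triDet at h0
  have e1 := (h2 ![r.1 - p.1, -(q.1 - p.1)] (by simp; ring)
    (by simp; linear_combination -h0)).2
  have e2 := (h2 ![r.2 - p.2, -(q.2 - p.2)] (by simp; linear_combination h0)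
    (by simp; ring)).2
  simp only [Matrix.cons_val_one, Matrix.cons_val_fin_one, neg_eq_zero] at e1 e2
  simpa using (h2 ![1, 0] (by simp [e1]) (by simp [e2])).1

/-- Points of a triangle as convex combinations of its vertices. -/
theorem mem_convexHull_triple {p q r w : ℝ × ℝ} :
    w ∈ convexHull ℝ {p, q, r} ↔ ∃ a b c : ℝ, 0 ≤ a ∧ 0 ≤ b ∧ 0 ≤ c ∧ a + b + c = 1 ∧
      w.1 = a * p.1 + b * q.1 + c * r.1 ∧ w.2 = a * p.2 + b * q.2 + c * r.2 := by
  rw [convexHull_insert (by simp), convexHull_pair]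
  constructor
  · intro h
    obtain ⟨_, rfl, z, ⟨b, c, hb, hc, hbc, rfl⟩, a, d, ha, hd, had, rfl⟩ := mem_convexJoin.1 h
    refine ⟨a, d * b, d * c, ha, by positivity, by positivity, ?_, ?_, ?_⟩
    · rw [add_assoc, ← mul_add, hbc, mul_one, had]
    · simp; ring
    · simp; ring
  · rintro ⟨a, b, c, ha, hb, hc, habc, h1, h2⟩
    rw [mem_convexJoin]
    refine ⟨p, rfl, ?_⟩
    by_cases hz : b + c = 0
    · have hb0 : b = 0 := by linarith
      have hc0 : c = 0 := by linarith
      have ha1 : a = 1 := by linarith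
      refine ⟨q, left_mem_segment _ _ _, ?_⟩
      have : w = p := by ext <;> simp [h1, h2, hb0, hc0, ha1]
      rw [this]; exact left_mem_segment _ _ _
    · have hpos : 0 < b + c := lt_of_le_of_ne (by positivity) (Ne.symm hz)
      refine ⟨(b / (b + c)) • q + (c / (b + c)) • r,
        ⟨b / (b + c), c / (b + c), by positivity, by positivity, by field_simp, rfl⟩,
        a, b + c, ha, hpos.le, by linarith, ?_⟩
      ext
      · simp [h1]; field_simp; ring
      · simp [h2]; field_simp; ring

/-- Barycentric coordinates with respect to a nondegenerate triangle are unique. -/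
theorem barycentric_eq_zero {p q r : ℝ × ℝ} (hD : triDet p q r ≠ 0) {a b c : ℝ}
    (hs : a + b + c = 0) (h1 : a * p.1 + b * q.1 + c * r.1 = 0)
    (h2 : a * p.2 + b * q.2 + c * r.2 = 0) : a = 0 ∧ b = 0 ∧ c = 0 := by
  have ha : a = -b - c := by linarith
  subst ha
  have hb : b * triDet p q r = 0 := by
    unfold triDet
    linear_combination (r.2 - p.2) * h1 - (r.1 - p.1) * h2
  have hc : c * triDet p q r = 0 := by
    unfold triDet
    linear_combination (q.1 - p.1) * h2 - (q.2 - p.2) * h1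
  have hb0 := (mul_eq_zero.1 hb).resolve_right hD
  have hc0 := (mul_eq_zero.1 hc).resolve_right hD
  exact ⟨by rw [hb0, hc0]; simp, hb0, hc0⟩

theorem mem_segment_iff_coords {p q w : ℝ × ℝ} :
    w ∈ segment ℝ p q ↔ ∃ a b : ℝ, 0 ≤ a ∧ 0 ≤ b ∧ a + b = 1 ∧
      w.1 = a * p.1 + b * q.1 ∧ w.2 = a * p.2 + b * q.2 := by
  constructor
  · rintro ⟨a, b, ha, hb, hab, rfl⟩
    exact ⟨a, b, ha, hb, hab, by simp, by simp⟩
  · rintro ⟨a, b, ha, hb, hab, h1, h2⟩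
    exact ⟨a, b, ha, hb, hab, by ext <;> simp [h1, h2]⟩

/-- Faces of a triangle are extreme subsets. -/
theorem IsFaceOf.isExtreme {F Δ : Set (ℝ × ℝ)} (hF : IsFaceOf F Δ) {u v w : ℝ × ℝ}
    (hu : u ∈ Δ) (hv : v ∈ Δ) (hw : w ∈ openSegment ℝ u v) (hwF : w ∈ F) : v ∈ F := by
  obtain ⟨p, q, r, hai, rfl, hF⟩ := hF
  have hD := triDet_ne_zero_of_affineIndependent hai
  obtain ⟨θ, η, hθ, hη, hθη, rfl⟩ := hw
  obtain ⟨a, b, c, ha, hb, hc, habc, hu1, hu2⟩ := mem_convexHull_triple.1 hu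
  obtain ⟨a', b', c', ha', hb', hc', habc', hv1, hv2⟩ := mem_convexHull_triple.1 hv
  have key : ∀ α β γ : ℝ, α + β + γ = 1 →
      (θ • u + η • v).1 = α * p.1 + β * q.1 + γ * r.1 →
      (θ • u + η • v).2 = α * p.2 + β * q.2 + γ * r.2 →
      (α = 0 → a' = 0) ∧ (β = 0 → b' = 0) ∧ (γ = 0 → c' = 0) := by
    intro α β γ h h1 h2
    simp only [Prod.fst_add, Prod.smul_fst, smul_eq_mul, Prod.snd_add, Prod.smul_snd] at h1 h2
    obtain ⟨e1, e2, e3⟩ := barycentric_eq_zero hD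
      (a := θ * a + η * a' - α) (b := θ * b + η * b' - β) (c := θ * c + η * c' - γ)
      (by linear_combination θ * habc + η * habc' + hθη - h)
      (by rw [hu1, hv1] at h1; linear_combination h1)
      (by rw [hu2, hv2] at h2; linear_combination h2)
    have aux : ∀ z z' : ℝ, 0 ≤ z → 0 ≤ z' → θ * z + η * z' = 0 → z' = 0 := by
      intro z z' hz hz' h
      have h1 : 0 ≤ θ * z := by positivity
      have h2 : 0 ≤ η * z' := by positivity
      exact (mul_eq_zero.1 (show η * z' = 0 by linarith)).resolve_left hη.ne'
    exact ⟨fun h => aux a a' ha ha' (by linarith), fun h => aux b b' hb hb' (by linarith),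
      fun h => aux c c' hc hc' (by linarith)⟩
  rcases hF with rfl | rfl | rfl | rfl | rfl | rfl | rfl | rfl
  · exact hwF.elim
  · rw [mem_singleton_iff] at hwF
    obtain ⟨-, h2, h3⟩ := key 1 0 0 (by norm_num) (by rw [hwF]; ring) (by rw [hwF]; ring)
    rw [h2 rfl, h3 rfl] at hv1 hv2 habc'
    have : a' = 1 := by linarith
    rw [mem_singleton_iff]; ext <;> simp [hv1, hv2, this]
  · rw [mem_singleton_iff] at hwF
    obtain ⟨h2, -, h3⟩ := key 0 1 0 (by norm_num) (by rw [hwF]; ring) (by rw [hwF]; ring)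
    rw [h2 rfl, h3 rfl] at hv1 hv2 habc'
    have : b' = 1 := by linarith
    rw [mem_singleton_iff]; ext <;> simp [hv1, hv2, this]
  · rw [mem_singleton_iff] at hwF
    obtain ⟨h2, h3, -⟩ := key 0 0 1 (by norm_num) (by rw [hwF]; ring) (by rw [hwF]; ring)
    rw [h2 rfl, h3 rfl] at hv1 hv2 habc'
    have : c' = 1 := by linarith
    rw [mem_singleton_iff]; ext <;> simp [hv1, hv2, this]
  · obtain ⟨α, β, -, -, h, h1, h2⟩ := mem_segment_iff_coords.1 hwF
    obtain ⟨-, -, h3⟩ := key α β 0 (by linarith) (by rw [h1]; ring) (by rw [h2]; ring)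
    rw [h3 rfl] at hv1 hv2 habc'
    exact mem_segment_iff_coords.2 ⟨a', b', ha', hb', by linarith, by linarith, by linarith⟩
  · obtain ⟨α, β, -, -, h, h1, h2⟩ := mem_segment_iff_coords.1 hwF
    obtain ⟨h3, -, -⟩ := key 0 α β (by linarith) (by rw [h1]; ring) (by rw [h2]; ring)
    rw [h3 rfl] at hv1 hv2 habc'
    exact mem_segment_iff_coords.2 ⟨b', c', hb', hc', by linarith, by linarith, by linarith⟩
  · obtain ⟨α, β, -, -, h, h1, h2⟩ := mem_segment_iff_coords.1 hwF
    obtain ⟨-, h3, -⟩ := key α 0 β (by linarith) (by rw [h1]; ring) (by rw [h2]; ring)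
    rw [h3 rfl] at hv1 hv2 habc'
    exact mem_segment_iff_coords.2 ⟨a', c', ha', hc', by linarith, by linarith, by linarith⟩
  · exact hv

theorem triDet_eq_zero_of_mem_segment {p q u v w : ℝ × ℝ} (hu : u ∈ segment ℝ p q)
    (hv : v ∈ segment ℝ p q) (hw : w ∈ segment ℝ p q) : triDet u v w = 0 := by
  obtain ⟨a, b, -, -, h, h1, h2⟩ := mem_segment_iff_coords.1 hu
  obtain ⟨a', b', -, -, h', h1', h2'⟩ := mem_segment_iff_coords.1 hv
  obtain ⟨a'', b'', -, -, h'', h1'', h2''⟩ := mem_segment_iff_coords.1 hw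
  obtain rfl : a = 1 - b := by linarith
  obtain rfl : a' = 1 - b' := by linarith
  obtain rfl : a'' = 1 - b'' := by linarith
  rw [triDet, h1, h2, h1', h2', h1'', h2'']
  ring

/-- A face containing three non-collinear points is the whole triangle. -/
theorem IsFaceOf.eq_of_triDet_ne_zero {F Δ : Set (ℝ × ℝ)} (hF : IsFaceOf F Δ) {u v w : ℝ × ℝ}
    (hu : u ∈ F) (hv : v ∈ F) (hw : w ∈ F) (hD : triDet u v w ≠ 0) : F = Δ := by
  obtain ⟨p, q, r, -, -, hF⟩ := hF
  have single : ∀ z, F = {z} → F = segment ℝ z z := fun z h => by rw [h, segment_same]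
  have seg : ∀ y z, F ≠ segment ℝ y z := by
    rintro y z rfl
    exact hD (triDet_eq_zero_of_mem_segment hu hv hw)
  rcases hF with rfl | h | h | h | h | h | h | h
  · exact hu.elim
  · exact (seg _ _ (single _ h)).elim
  · exact (seg _ _ (single _ h)).elim
  · exact (seg _ _ (single _ h)).elim
  · exact (seg _ _ h).elim
  · exact (seg _ _ h).elim
  · exact (seg _ _ h).elim
  · exact h

/-- `Δ` is the unimodular triangle with vertices `p, q, r`. -/
structure UnimodularVertices (Δ : Set (ℝ × ℝ)) (p q r : ℝ × ℝ) : Prop where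
  left : IsLatticePoint p
  mid : IsLatticePoint q
  right : IsLatticePoint r
  eq_hull : Δ = convexHull ℝ {p, q, r}
  abs_det : |triDet p q r| = 1

namespace UnimodularVertices

variable {Δ : Set (ℝ × ℝ)} {p q r : ℝ × ℝ}

theorem swap (h : UnimodularVertices Δ p q r) : UnimodularVertices Δ q p r where
  left := h.mid
  mid := h.left
  right := h.right
  eq_hull := by rw [h.eq_hull, Set.insert_comm]
  abs_det := by
    rw [← h.abs_det, ← abs_neg]
    congr 1
    unfold triDet
    ring

theorem rotate (h : UnimodularVertices Δ p q r) : UnimodularVertices Δ q r p where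
  left := h.mid
  mid := h.right
  right := h.left
  eq_hull := by rw [h.eq_hull, Set.insert_comm, Set.pair_comm p r]
  abs_det := by
    rw [← h.abs_det]
    congr 1
    unfold triDet
    ring

theorem det_ne_zero (h : UnimodularVertices Δ p q r) : triDet p q r ≠ 0 := by
  intro h0
  have := h.abs_det
  simp [h0] at this

theorem convex (h : UnimodularVertices Δ p q r) : Convex ℝ Δ := by
  rw [h.eq_hull]; exact convex_convexHull _ _

theorem isClosed (h : UnimodularVertices Δ p q r) : IsClosed Δ := by
  rw [h.eq_hull]
  exact ((Set.toFinite {p, q, r}).isCompact_convexHull ℝ).isClosed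

theorem left_mem (h : UnimodularVertices Δ p q r) : p ∈ Δ := by
  rw [h.eq_hull]; exact subset_convexHull _ _ (by simp)

theorem mid_mem (h : UnimodularVertices Δ p q r) : q ∈ Δ := h.rotate.left_mem

theorem right_mem (h : UnimodularVertices Δ p q r) : r ∈ Δ := h.rotate.rotate.left_mem

end UnimodularVertices

theorem IsUnimodularTriangle.exists_vertices {Δ : Set (ℝ × ℝ)} (h : IsUnimodularTriangle Δ) :
    ∃ p q r, UnimodularVertices Δ p q r := by
  obtain ⟨p, q, r, hp, hq, hr, -, hΔ, hD⟩ := h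
  exact ⟨p, q, r, hp, hq, hr, hΔ, hD⟩

/-- Distinct abscissae of lattice points differ by at least one. -/
theorem IsLatticePoint.one_le_abs_fst_sub {p q : ℝ × ℝ} (hp : IsLatticePoint p)
    (hq : IsLatticePoint q) (h : p.1 ≠ q.1) : 1 ≤ |p.1 - q.1| := by
  obtain ⟨a, b, rfl⟩ := hp
  obtain ⟨c, d, rfl⟩ := hq
  have hac : a - c ≠ 0 := by
    intro h0
    exact h (by simp [show a = c by linarith])
  have := Int.one_le_abs hac
  simp only
  exact_mod_cast this

/-- Vertical chords of a unimodular triangle have length at most one. -/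
theorem IsUnimodularTriangle.vertical_sub_le_one {Δ : Set (ℝ × ℝ)} (h : IsUnimodularTriangle Δ)
    {x y z : ℝ} (hy : (x, y) ∈ Δ) (hz : (x, z) ∈ Δ) : z - y ≤ 1 := by
  obtain ⟨p, q, r, hV⟩ := h.exists_vertices
  have main : ∀ {p q r : ℝ × ℝ}, UnimodularVertices Δ p q r → p.1 ≠ q.1 → z - y ≤ 1 := by
    intro p q r hV hne
    rw [hV.eq_hull, mem_convexHull_triple] at hy hz
    obtain ⟨a, b, c, ha, hb, hc, h, h1, h2⟩ := hy
    obtain ⟨a', b', c', ha', hb', hc', h', h1', h2'⟩ := hz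
    simp only at h1 h2 h1' h2'
    have e : (z - y) * (q.1 - p.1) = (c' - c) * triDet p q r := by
      obtain rfl : a = 1 - b - c := by linarith
      obtain rfl : a' = 1 - b' - c' := by linarith
      rw [h2, h2']
      unfold triDet
      have : (b' - b) * (q.1 - p.1) + (c' - c) * (r.1 - p.1) = 0 := by
        linear_combination h1 - h1'
      linear_combination (q.2 - p.2) * this
    have e2 : |z - y| * |q.1 - p.1| = |c' - c| := by
      rw [← abs_mul, e, abs_mul, hV.abs_det, mul_one]
    have h3 : |c' - c| ≤ 1 := by rw [abs_le]; constructor <;> linarith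
    have h4 : 1 ≤ |q.1 - p.1| := hV.mid.one_le_abs_fst_sub hV.left hne.symm
    have h5 : |z - y| ≤ 1 := by nlinarith [abs_nonneg (z - y)]
    exact (le_abs_self _).trans h5
  by_cases hpq : p.1 = q.1
  · by_cases hpr : q.1 = r.1
    · refine (hV.det_ne_zero ?_).elim
      simp [triDet, hpq, hpr]
    · exact main hV.rotate hpr
  · exact main hV hpq

/-- A unimodular triangle has a point off any given vertical line. -/
theorem IsUnimodularTriangle.exists_fst_ne {Δ : Set (ℝ × ℝ)} (h : IsUnimodularTriangle Δ)
    (x : ℝ) : ∃ p ∈ Δ, p.1 ≠ x := by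
  obtain ⟨p, q, r, hV⟩ := h.exists_vertices
  by_contra! hc
  refine hV.det_ne_zero ?_
  simp [triDet, hc p hV.left_mem, hc q hV.mid_mem, hc r hV.right_mem]

/-- A unimodular triangle lying on one side of a vertical line which it touches meets the line
either in a vertex or in a vertical edge of unit length. -/
theorem IsUnimodularTriangle.touching_cases {Δ : Set (ℝ × ℝ)} (h : IsUnimodularTriangle Δ)
    {s x y : ℝ} (hs : ∀ p ∈ Δ, s * (p.1 - x) ≤ 0) (hs0 : s ≠ 0) (hy : (x, y) ∈ Δ) :
    ∃ p q r, UnimodularVertices Δ p q r ∧ p.1 = x ∧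
      ((s * (q.1 - x) < 0 ∧ s * (r.1 - x) < 0 ∧ ∀ y, (x, y) ∈ Δ → y = p.2) ∨ (q.1 = x ∧ q.2 = p.2 + 1)) := by
  obtain ⟨p, q, r, hV⟩ := h.exists_vertices
  have off : ∀ z ∈ Δ, z.1 ≠ x → s * (z.1 - x) < 0 := fun z hz hne =>
    lt_of_le_of_ne (hs z hz) (mul_ne_zero hs0 (sub_ne_zero.2 hne))
  have two : ∀ {p q r : ℝ × ℝ}, UnimodularVertices Δ p q r → p.1 = x → q.1 = x →
      ∃ p q r, UnimodularVertices Δ p q r ∧ p.1 = x ∧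
      ((s * (q.1 - x) < 0 ∧ s * (r.1 - x) < 0 ∧ ∀ y, (x, y) ∈ Δ → y = p.2) ∨ (q.1 = x ∧ q.2 = p.2 + 1)) := by
    intro p q r hV hp hq
    have hd := hV.abs_det
    have hd2 : |p.2 - q.2| * |r.1 - p.1| = 1 := by
      rw [← abs_mul, ← hd]; congr 1; unfold triDet; rw [hp, hq]; ring
    have hr1 : r.1 ≠ p.1 := by
      intro h0
      simp [h0] at hd2
    have h1 := hV.right.one_le_abs_fst_sub hV.left hr1
    have hle : |p.2 - q.2| ≤ 1 := by nlinarith [abs_nonneg (p.2 - q.2)]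
    have hne : p.2 ≠ q.2 := by
      intro h0
      simp [h0] at hd2
    obtain ⟨a, b, hab⟩ := hV.left
    obtain ⟨c, d, hcd⟩ := hV.mid
    have hbd : b ≠ d := by
      rintro rfl
      exact hne (by simp [hab, hcd])
    have hle' : |b - d| ≤ 1 := by
      have : p.2 - q.2 = ((b - d : ℤ) : ℝ) := by simp [hab, hcd]
      rw [this] at hle
      exact_mod_cast hle
    rw [abs_le] at hle'
    rcases lt_or_gt_of_ne hbd with hlt | hlt
    · refine ⟨p, q, r, hV, hp, Or.inr ⟨hq, ?_⟩⟩
      have : d = b + 1 := by lia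
      simp [hab, hcd, this]
    · refine ⟨q, p, r, hV.swap, hq, Or.inr ⟨hp, ?_⟩⟩
      have : b = d + 1 := by lia
      simp [hab, hcd, this]
  have one : ∀ {p q r : ℝ × ℝ}, UnimodularVertices Δ p q r → q.1 ≠ x → r.1 ≠ x →
      ∃ p q r, UnimodularVertices Δ p q r ∧ p.1 = x ∧
      ((s * (q.1 - x) < 0 ∧ s * (r.1 - x) < 0 ∧ ∀ y, (x, y) ∈ Δ → y = p.2) ∨ (q.1 = x ∧ q.2 = p.2 + 1)) := by
    intro p q r hV hq hr
    have hq' := off q hV.mid_mem hq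
    have hr' := off r hV.right_mem hr
    have hp' := hs p hV.left_mem
    have fiber : ∀ y, (x, y) ∈ Δ → x = p.1 ∧ y = p.2 := by
      intro y hy
      rw [hV.eq_hull, mem_convexHull_triple] at hy
      obtain ⟨a, b, c, ha, hb, hc, habc, h1, h2⟩ := hy
      have e : a * (s * (p.1 - x)) + b * (s * (q.1 - x)) + c * (s * (r.1 - x)) = 0 := by
        simp only at h1
        linear_combination (-s) * h1 - s * x * habc
      have ea := mul_nonpos_of_nonneg_of_nonpos ha hp'
      have eb := mul_nonpos_of_nonneg_of_nonpos hb hq'.le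
      have ec := mul_nonpos_of_nonneg_of_nonpos hc hr'.le
      have hb0 : b = 0 :=
        (mul_eq_zero.1 (show b * (s * (q.1 - x)) = 0 by linarith)).resolve_right hq'.ne
      have hc0 : c = 0 :=
        (mul_eq_zero.1 (show c * (s * (r.1 - x)) = 0 by linarith)).resolve_right hr'.ne
      have ha1 : a = 1 := by linarith
      simp only [ha1, hb0, hc0] at h1 h2
      exact ⟨by linarith, by linarith⟩
    exact ⟨p, q, r, hV, (fiber y hy).1.symm, Or.inl ⟨hq', hr', fun y hy => (fiber y hy).2⟩⟩
  by_cases hp : p.1 = x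
  · by_cases hq : q.1 = x
    · exact two hV hp hq
    · by_cases hr : r.1 = x
      · exact two hV.rotate.rotate hr hp
      · exact one hV hq hr
  · by_cases hq : q.1 = x
    · by_cases hr : r.1 = x
      · exact two hV.rotate hq hr
      · exact one hV.rotate hr hp
    · exact one hV.rotate.rotate hp hq

/-- If finitely many closed sets cover the segment `[z, z']`, one of them contains `z` together
with another point of the segment. -/
theorem exists_mem_and_lineMap_mem {T : Set (Set (ℝ × ℝ))} (hT : T.Finite)
    (hc : ∀ Δ ∈ T, IsClosed Δ) {z z' : ℝ × ℝ} (hz : segment ℝ z z' ⊆ ⋃₀ T) :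
    ∃ Δ ∈ T, z ∈ Δ ∧ ∃ t : ℝ, 0 < t ∧ z + t • (z' - z) ∈ Δ := by
  have hev : ∀ᶠ t : ℝ in 𝓝[>] 0, ∃ Δ ∈ T, z + t • (z' - z) ∈ Δ := by
    filter_upwards [Ioo_mem_nhdsGT (zero_lt_one' ℝ)] with t ht
    have : z + t • (z' - z) ∈ segment ℝ z z' := by
      rw [segment_eq_image']
      exact ⟨t, ⟨ht.1.le, ht.2.le⟩, rfl⟩
    simpa using hz this
  have hfr : ∃ Δ ∈ T, ∃ᶠ t : ℝ in 𝓝[>] 0, z + t • (z' - z) ∈ Δ := by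
    by_contra! hcon
    have h2 := (Filter.eventually_all_finite hT).2 hcon
    obtain ⟨t, ⟨Δ, hΔ, h⟩, h'⟩ := (hev.and h2).exists
    exact h' Δ hΔ h
  obtain ⟨Δ, hΔ, hf⟩ := hfr
  refine ⟨Δ, hΔ, ?_, ?_⟩
  · have hcont : Continuous fun t : ℝ => z + t • (z' - z) := by fun_prop
    have ht : Tendsto (fun t : ℝ => z + t • (z' - z)) (𝓝[>] 0) (𝓝 z) := by
      have := (hcont.tendsto 0).mono_left (nhdsWithin_le_nhds (s := Set.Ioi 0))
      simpa using this
    exact (hc Δ hΔ).mem_of_frequently_of_tendsto hf ht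
  · obtain ⟨t, ht, ht0⟩ := (hf.and_eventually self_mem_nhdsWithin).exists
    exact ⟨t, ht0, ht⟩

/-- Two segments leaving a vertical line on the same side, the first one starting strictly below
the second one: close to the line there are points of them on a common vertical line, in the same
order, and the lower one avoids a given closed set not containing its start. -/
theorem exists_vertical_pair {s x y z : ℝ} {p q : ℝ × ℝ} (hyz : y < z)
    (hp : 0 < s * (p.1 - x)) (hq : 0 < s * (q.1 - x)) {C : Set (ℝ × ℝ)} (hC : IsClosed C)
    (hyC : (x, y) ∉ C) :
    ∃ t u : ℝ, 0 < t ∧ t < 1 ∧ 0 < u ∧ u < 1 ∧ x + t * (p.1 - x) = x + u * (q.1 - x) ∧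
      y + t * (p.2 - y) < z + u * (q.2 - z) ∧
      (x + t * (p.1 - x), y + t * (p.2 - y)) ∉ C := by
  have hp0 : p.1 - x ≠ 0 := by intro h; simp [h] at hp
  have hq0 : q.1 - x ≠ 0 := by intro h; simp [h] at hq
  set k := (p.1 - x) / (q.1 - x) with hk
  have hkq : k * (q.1 - x) = p.1 - x := by rw [hk]; field_simp
  have hk0 : 0 < k := by
    have : 0 < k * (s * (q.1 - x)) := by rw [← hkq] at hp; linarith
    exact pos_of_mul_pos_left this hq.le
  have ev1 : ∀ᶠ t : ℝ in 𝓝 0, t * k < 1 := by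
    have : Continuous fun t : ℝ => t * k := by fun_prop
    exact (this.tendsto 0).eventually_lt_const (by simp)
  have ev2 : ∀ᶠ t : ℝ in 𝓝 0, y + t * (p.2 - y) < z + t * k * (q.2 - z) := by
    have h1 : Continuous fun t : ℝ => y + t * (p.2 - y) := by fun_prop
    have h2 : Continuous fun t : ℝ => z + t * k * (q.2 - z) := by fun_prop
    exact (h1.tendsto 0).eventually_lt (h2.tendsto 0) (by simpa using hyz)
  have ev3 : ∀ᶠ t : ℝ in 𝓝 0, (x + t * (p.1 - x), y + t * (p.2 - y)) ∈ Cᶜ := by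
    have h1 : Continuous fun t : ℝ => (x + t * (p.1 - x), y + t * (p.2 - y)) := by fun_prop
    exact (h1.tendsto 0).eventually_mem (hC.isOpen_compl.mem_nhds (by simpa using hyC))
  have ev4 : ∀ᶠ t : ℝ in 𝓝[>] 0, t * k < 1 ∧
      y + t * (p.2 - y) < z + t * k * (q.2 - z) ∧
      (x + t * (p.1 - x), y + t * (p.2 - y)) ∈ Cᶜ :=
    (ev1.and (ev2.and ev3)).filter_mono nhdsWithin_le_nhds
  obtain ⟨t, ⟨h1, h2, h3⟩, h4⟩ := (ev4.and (Ioo_mem_nhdsGT (zero_lt_one' ℝ))).exists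
  exact ⟨t, t * k, h4.1, h4.2, mul_pos h4.1 hk0, h1, by rw [mul_assoc, hkq], h2, h3⟩

theorem Convex.mem_of_coords {C : Set (ℝ × ℝ)} (hC : Convex ℝ C) {x y t : ℝ} {p : ℝ × ℝ}
    (hx : (x, y) ∈ C) (hp : p ∈ C) (h0 : 0 ≤ t) (h1 : t ≤ 1) :
    (x + t * (p.1 - x), y + t * (p.2 - y)) ∈ C := by
  convert hC.add_smul_sub_mem hx hp ⟨h0, h1⟩ using 1
  ext <;> simp

/-- Below an upper boundary segment: a convex part of `S` reaching to the side of the segment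
cannot meet the vertical line above the start of the segment. -/
theorem le_of_upper_segment {S C : Set (ℝ × ℝ)} (hCS : C ⊆ S) (hC : Convex ℝ C)
    {s x y z : ℝ} {p q : ℝ × ℝ}
    (htop : ∀ w ∈ openSegment ℝ (x, y) p, ∀ ε : ℝ, 0 < ε → w + (0, ε) ∉ S)
    (hp : 0 < s * (p.1 - x)) (hz : (x, z) ∈ C) (hqC : q ∈ C) (hq : 0 < s * (q.1 - x)) :
    z ≤ y := by
  by_contra! hlt
  obtain ⟨t, u, ht0, ht1, hu0, hu1, hx, hlt', -⟩ :=
    exists_vertical_pair hlt hp hq isClosed_empty (notMem_empty _)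
  refine htop (x + t * (p.1 - x), y + t * (p.2 - y)) ?_ _ (sub_pos.2 hlt') ?_
  · rw [openSegment_eq_image']
    exact ⟨t, ⟨ht0, ht1⟩, by ext <;> simp⟩
  · have := hCS (hC.mem_of_coords hz hqC hu0.le hu1.le)
    simpa [hx] using this

theorem upper_segment_step {P : Set (ℝ × ℝ)} (hP : Convex ℝ P) {T₀ T : Set (Set (ℝ × ℝ))}
    (hT₀ : IsUnimodularTriangulation P T₀) (hsub : T ⊆ T₀)
    (hlow : ∀ Δ ∈ T, ∀ Δ' ∈ T₀, LiesAbove Δ' Δ → Δ' ∈ T)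
    {s x L R : ℝ} {A B : ℝ × ℝ} (hA : 0 < s * (A.1 - x)) (hB : s * (B.1 - x) < 0)
    (hAS : segment ℝ (x, L) A ⊆ ⋃₀ T) (hBS : segment ℝ (x, R) B ⊆ ⋃₀ T)
    (hAtop : ∀ w ∈ openSegment ℝ (x, L) A, ∀ ε : ℝ, 0 < ε → w + (0, ε) ∉ ⋃₀ T)
    (hBtop : ∀ w ∈ openSegment ℝ (x, R) B, ∀ ε : ℝ, 0 < ε → w + (0, ε) ∉ ⋃₀ T)
    (hLR : L < R) : R = L + 1 := by
  obtain ⟨hfin, huni, hcover, hface⟩ := hT₀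
  have hs0 : s ≠ 0 := by rintro rfl; simp at hA
  have hclosed : ∀ Δ ∈ T₀, IsClosed Δ := fun Δ hΔ =>
    let ⟨_, _, _, h⟩ := (huni Δ hΔ).1.exists_vertices; h.isClosed
  have hconv : ∀ Δ ∈ T₀, Convex ℝ Δ := fun Δ hΔ =>
    let ⟨_, _, _, h⟩ := (huni Δ hΔ).1.exists_vertices; h.convex
  have hSP : ⋃₀ T ⊆ P := hcover ▸ sUnion_subset_sUnion hsub
  -- triangles of `T` meeting the vertical line above `L` stay on the side of `B`
  have above : ∀ Δ ∈ T, ∀ y, (x, y) ∈ Δ → L < y → ∀ p ∈ Δ, s * (p.1 - x) ≤ 0 := by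
    intro Δ hΔ y hy hLy p hp
    by_contra! hpos
    exact hLy.not_ge (le_of_upper_segment (subset_sUnion_of_mem hΔ) (hconv Δ (hsub hΔ))
      hAtop hA hy hp hpos)
  have le_R : ∀ Δ ∈ T, ∀ y, (x, y) ∈ Δ → y ≤ R := by
    intro Δ hΔ y hy
    by_contra! hRy
    obtain ⟨p, hp, hpx⟩ := (huni Δ (hsub hΔ)).1.exists_fst_ne x
    have h1 : s * (p.1 - x) < 0 := lt_of_le_of_ne (above Δ hΔ y hy (hLR.trans hRy) p hp)
      (mul_ne_zero hs0 (sub_ne_zero.2 hpx))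
    exact hRy.not_ge (le_of_upper_segment (s := -s) (subset_sUnion_of_mem hΔ)
      (hconv Δ (hsub hΔ)) hBtop (by linarith) hy hp (by linarith))
  have hL : (x, L) ∈ P := hSP (hAS (left_mem_segment _ _ _))
  have hR : (x, R) ∈ P := hSP (hBS (left_mem_segment _ _ _))
  have hline : ∀ y, L < y → y < R → (x, y) ∈ P := by
    intro y h1 h2
    have := hP.mem_of_coords hL hR (t := (y - L) / (R - L))
      (div_nonneg (by linarith) (by linarith)) ((div_le_one (by linarith)).2 (by linarith))
    have h3 : R - L ≠ 0 := by linarith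
    simpa [div_mul_cancel₀ _ h3] using this
  -- a triangle of `T` with the unit vertical edge ending at `(x, R)`
  have edge : ∃ Δ ∈ T, (x, R - 1) ∈ Δ ∧ (x, R) ∈ Δ := by
    obtain ⟨Δ, hΔ, hRΔ⟩ := hBS (left_mem_segment _ _ _)
    obtain ⟨p, q, r, hV, hpx, ⟨hq, hr, hfib⟩ | ⟨hqx, hq⟩⟩ :=
      (huni Δ (hsub hΔ)).1.touching_cases (above Δ hΔ R hRΔ hLR) hs0 hRΔ
    · obtain rfl : p = (x, R) := by ext <;> simp [hpx, hfib R hRΔ]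
      obtain ⟨y, hy, hyR⟩ := exists_between (max_lt hLR (sub_one_lt R))
      obtain ⟨hLy, hRy⟩ := max_lt_iff.1 hy
      have hyΔ : (x, y) ∉ Δ := by
        exact fun hmem => hyR.ne (hfib y hmem)
      have hyP := hline y hLy hyR
      obtain ⟨Δ', hΔ', hyΔ', t, ht, htΔ'⟩ := exists_mem_and_lineMap_mem hfin hclosed
        (z := (x, y)) (z' := B)
        (hcover ▸ hP.segment_subset hyP (hSP (hBS (right_mem_segment _ _ _))))
      have hside : s * (((x, y) + t • (B - (x, y))).1 - x) < 0 := by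
        have : s * (((x, y) + t • (B - (x, y))).1 - x) = t * (s * (B.1 - x)) := by
          simp; ring
        rw [this]
        exact mul_neg_of_pos_of_neg ht hB
      have hΔ'T : Δ' ∈ T := by
        by_contra hnot
        have hnl : ¬ LiesAbove Δ' Δ := fun h => hnot (hlow Δ hΔ Δ' hΔ' h)
        have hRΔ' : (x, R) ∈ Δ' := by
          by_contra h
          exact hnl ⟨x, y, R, ⟨hyΔ', hyΔ⟩, ⟨hRΔ, h⟩, hyR⟩
        have near : ∀ v ∈ Δ, s * (v.1 - x) < 0 → ∃ u : ℝ, 0 < u ∧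
            (x + u * (v.1 - x), R + u * (v.2 - R)) ∈ Δ' ∩ Δ := by
          intro v hv hvs
          obtain ⟨t, u, ht0, ht1, hu0, hu1, hx, hlt', hnC⟩ :=
            exists_vertical_pair (s := -s)
              (p := (x, y) + t • (B - (x, y))) hyR (by linarith) (by linarith : 0 < -s * (v.1 - x))
              (hclosed Δ (hsub hΔ)) hyΔ
          have h1 := (hconv Δ' hΔ').mem_of_coords hyΔ' htΔ' ht0.le ht1.le
          have h2 := (hconv Δ (hsub hΔ)).mem_of_coords hRΔ hv hu0.le hu1.le
          refine ⟨u, hu0, ?_, h2⟩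
          by_contra h
          refine hnl ⟨_, _, _, ⟨h1, hnC⟩, ⟨?_, ?_⟩, hlt'⟩
          · rw [hx]; exact h2
          · rw [hx]; exact h
        obtain ⟨u, hu, hu'⟩ := near q hV.mid_mem hq
        obtain ⟨v, hv, hv'⟩ := near r hV.right_mem hr
        have hD : triDet (x, R) (x + u * (q.1 - x), R + u * (q.2 - R))
            (x + v * (r.1 - x), R + v * (r.2 - R)) ≠ 0 := by
          have : triDet (x, R) (x + u * (q.1 - x), R + u * (q.2 - R))
            (x + v * (r.1 - x), R + v * (r.2 - R)) = u * v * triDet (x, R) q r := by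
            simp only [triDet]; ring
          rw [this]
          exact mul_ne_zero (mul_pos hu hv).ne' hV.det_ne_zero
        have hf := hface Δ' hΔ' Δ (hsub hΔ)
        have e1 := hf.1.eq_of_triDet_ne_zero ⟨hRΔ', hRΔ⟩ hu' hv' hD
        have e2 := hf.2.eq_of_triDet_ne_zero ⟨hRΔ', hRΔ⟩ hu' hv' hD
        exact hyΔ (e2 ▸ e1.symm ▸ hyΔ')
      obtain ⟨p', q', r', hV', hpx', ⟨-, -, hfib'⟩ | ⟨hqx', hq'⟩⟩ :=
        (huni Δ' hΔ').1.touching_cases (above Δ' hΔ'T y hyΔ' hLy) hs0 hyΔ'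
      · exfalso
        have hyp' := hfib' y hyΔ'
        obtain ⟨a, b, hab⟩ := hV'.left
        obtain ⟨c, d, hcd⟩ := hV.left
        simp only [Prod.ext_iff] at hab hcd
        have h1 : b < d := by exact_mod_cast (by linarith : (b : ℝ) < d)
        have h2 : d < b + 1 := by exact_mod_cast (by linarith : (d : ℝ) < b + 1)
        lia
      · have hp'Δ : (x, p'.2) ∈ Δ' := by rw [← hpx']; exact hV'.left_mem
        have hq'Δ : (x, p'.2 + 1) ∈ Δ' := by rw [← hqx', ← hq']; exact hV'.mid_mem
        have h1 := (huni Δ' hΔ').1.vertical_sub_le_one hp'Δ hyΔ'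
        have h2 := (huni Δ' hΔ').1.vertical_sub_le_one hyΔ' hq'Δ
        have h3 := le_R Δ' hΔ'T _ hq'Δ
        have : p'.2 + 1 = R := by
          obtain ⟨a, b, hab⟩ := hV'.left
          obtain ⟨c, d, hcd⟩ := hV.left
          simp only [Prod.ext_iff] at hab hcd
          have h4 : b + 1 ≤ d := by exact_mod_cast (by linarith : (b : ℝ) + 1 ≤ d)
          have h5 : d < b + 2 := by exact_mod_cast (by linarith : (d : ℝ) < b + 2)
          have h6 : d = b + 1 := by lia
          rw [hab.2, hcd.2, h6]; simp
        refine ⟨Δ', hΔ'T, ?_, this ▸ hq'Δ⟩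
        rw [← this, add_sub_cancel_right]
        exact hp'Δ
    · have hpΔ : (x, p.2) ∈ Δ := by rw [← hpx]; exact hV.left_mem
      have hqΔ : (x, p.2 + 1) ∈ Δ := by rw [← hqx, ← hq]; exact hV.mid_mem
      have h1 := (huni Δ (hsub hΔ)).1.vertical_sub_le_one hpΔ hRΔ
      have h2 := le_R Δ hΔ _ hqΔ
      have h3 : p.2 = R - 1 := by linarith
      exact ⟨Δ, hΔ, h3 ▸ hpΔ, hRΔ⟩
  obtain ⟨Δ, hΔ, hR1Δ, hRΔ⟩ := edge
  rcases lt_trichotomy L (R - 1) with hlt | heq | hgt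
  · exfalso
    obtain ⟨y, hLy, hyR⟩ := exists_between hlt
    have hyP := hline y hLy (by linarith)
    obtain ⟨Δ', hΔ', hyΔ', t, ht, htΔ'⟩ := exists_mem_and_lineMap_mem hfin hclosed
      (z := (x, y)) (z' := A)
      (hcover ▸ hP.segment_subset hyP (hSP (hAS (right_mem_segment _ _ _))))
    have hside : s * (((x, y) + t • (A - (x, y))).1 - x) = t * (s * (A.1 - x)) := by
      simp; ring
    have hΔ'T : Δ' ∉ T := by
      intro h
      have := above Δ' h y hyΔ' hLy _ htΔ'
      rw [hside] at this
      exact this.not_gt (mul_pos ht hA)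
    have hyΔ : (x, y) ∉ Δ := by
      intro h
      have := (huni Δ (hsub hΔ)).1.vertical_sub_le_one h hRΔ
      linarith
    refine hΔ'T (hlow Δ hΔ Δ' hΔ' ⟨x, y, R, ⟨hyΔ', hyΔ⟩, ⟨hRΔ, ?_⟩, by linarith⟩)
    intro h
    have := (huni Δ' hΔ').1.vertical_sub_le_one hyΔ' h
    linarith
  · linarith
  · exfalso
    obtain ⟨Δ', hΔ', hLΔ', t, ht, htΔ'⟩ := exists_mem_and_lineMap_mem (hfin.subset hsub)
      (fun Δ h => hclosed Δ (hsub h)) hAS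
    have hside : s * (((x, L) + t • (A - (x, L))).1 - x) = t * (s * (A.1 - x)) := by
      simp; ring
    have hLΔ : (x, L) ∈ openSegment ℝ (x, R - 1) (x, R) := by
      refine ⟨R - L, L - (R - 1), by linarith, by linarith, by ring, ?_⟩
      ext <;> simp <;> ring
    have hLΔ2 : (x, L) ∈ Δ :=
      (hconv Δ (hsub hΔ)).openSegment_subset hR1Δ hRΔ hLΔ
    have hmem := (hface Δ' (hsub hΔ') Δ (hsub hΔ)).2.isExtreme hR1Δ hRΔ hLΔ ⟨hLΔ', hLΔ2⟩
    have := above Δ' hΔ' R hmem.1 hLR _ htΔ'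
    rw [hside] at this
    exact this.not_gt (mul_pos ht hA)

/-- The members of an admissible sequence are lower sets of the initial triangulation. -/
theorem IsAdmissibleSeq.subset_and_lower {m n : ℕ} {T : ℕ → Set (Set (ℝ × ℝ))}
    (hT : IsAdmissibleSeq m n T) {i : ℕ} (h1 : 1 ≤ i) (hi : i ≤ 2 * m * n) :
    T i ⊆ T 1 ∧ ∀ Δ ∈ T i, ∀ Δ' ∈ T 1, LiesAbove Δ' Δ → Δ' ∈ T i := by
  induction i, h1 using Nat.le_induction with
  | base => exact ⟨subset_rfl, fun _ _ _ h _ => h⟩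
  | succ k hk ih =>
    obtain ⟨ih1, ih2⟩ := ih (by lia)
    obtain ⟨D, hD, hDT⟩ := hT.2 (k + 1) (by lia) hi
    rw [Nat.add_sub_cancel] at hD hDT
    rw [hDT]
    refine ⟨sdiff_subset.trans ih1, fun Δ hΔ Δ' hΔ' hab => ⟨ih2 Δ hΔ.1 Δ' hΔ' hab, ?_⟩⟩
    rintro rfl
    exact hD.2 Δ hΔ.1 hab

/-- Consecutive upper boundary segments of an admissible shape meet with a
vertical jump of height at most `1`. -/
theorem upper_boundary_jump (m n : ℕ) (hm : 1 ≤ m) (hn : 1 ≤ n)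
    (S : Set (ℝ × ℝ)) (hS : IsAdmissibleShape m n S)
    (t : ℕ) (l r : ℕ → ℝ × ℝ) (hb : IsUpperBoundary m S t l r) :
    ∀ j, 2 ≤ j → j ≤ t →
      (l j).2 ∈ ({(r (j - 1)).2 - 1, (r (j - 1)).2, (r (j - 1)).2 + 1} : Set ℝ) := by
  intro j hj hjt
  obtain ⟨T, i, hT, h1, hi, rfl⟩ := hS
  obtain ⟨hsub, hlow⟩ := hT.subset_and_lower h1 hi
  obtain ⟨-, -, -, hx, hlt, hseg, htop⟩ := hb
  have hxj := hx j hj hjt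
  have hl1 := hlt (j - 1) (by lia) (by lia)
  have hl2 := hlt j (by lia) hjt
  have hs1 := hseg (j - 1) (by lia) (by lia)
  have hs2 := hseg j (by lia) hjt
  have ht1 := htop (j - 1) (by lia) (by lia)
  have ht2 := htop j (by lia) hjt
  rw [segment_symm] at hs1
  rw [openSegment_symm] at ht1
  have e1 : r (j - 1) = ((l j).1, (r (j - 1)).2) := by rw [hxj]
  have e2 : l j = ((l j).1, (l j).2) := rfl
  rw [e1] at hs1 ht1
  rw [e2] at hs2 ht2
  rcases lt_trichotomy (l j).2 (r (j - 1)).2 with h | h | h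
  · have := upper_segment_step (s := 1) (convex_Icc _ _) hT.1 hsub hlow (by linarith)
      (by linarith) hs2 hs1 ht2 ht1 h
    left
    linarith
  · right; left; exact h
  · have := upper_segment_step (s := -1) (convex_Icc _ _) hT.1 hsub hlow (by linarith)
      (by linarith) hs1 hs2 ht1 ht2 h
    right; right
    exact this
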